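/- (Anisotropic commutator estimate.) For any integer k ≥ 1 and sufficiently smooth functions a, f on Ω, the commutator [∂_x^k, a]f = ∂_x^k(a f) − a ∂_x^k f satisfies ‖[∂_x^k, a] f‖ ≲ ‖a_x‖_{L^∞} ‖∂_x^{k−1} f‖ + (‖∂_x^k a‖ + ‖∂_x^k a_y‖)(‖f‖ + ‖f_x‖), with implicit constant depending only on k. -/

import Mathlib

open MeasureTheory Real

noncomputable section

/-- Functions on the strip `Ω = 𝕋 × (0,1)` (the flat torus `𝕋 = ℝ/ℤ` is modelled by
`1`-periodic functions of `x ∈ ℝ`); arguments `(x, y)`. -/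
abbrev SF : Type := ℝ → ℝ → ℝ

/-- Partial derivative in the horizontal variable `x`. -/
def pdx (f : SF) : SF := fun x y => deriv (fun s => f s y) x
/-- Partial derivative in the vertical variable `y`. -/
def pdy (f : SF) : SF := fun x y => deriv (fun s => f x s) y
/-- Iterated `x`-derivative `∂_x^n`. -/
def pdxn (n : ℕ) (f : SF) : SF := pdx^[n] f
/-- Iterated `y`-derivative `∂_y^n`. -/
def pdyn (n : ℕ) (f : SF) : SF := pdy^[n] f

/-- Squared `L²(Ω)` norm `‖f‖²`. -/
def nSq (f : SF) : ℝ := ∫ x in (0:ℝ)..1, ∫ y in (0:ℝ)..1, (f x y)^2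
/-- Squared trace norm `|f|₀²` on `Γ = {y = 1}`. -/
def trSq (f : SF) : ℝ := ∫ x in (0:ℝ)..1, (f x 1)^2
/-- `L^∞(Ω)` norm (for continuous `1`-periodic functions). -/
def linf (f : SF) : ℝ := ⨆ q : Set.Icc (0:ℝ) 1 × Set.Icc (0:ℝ) 1, |f q.1.1 q.2.1|
/-- The vertical antiderivative `∂_y^{-1} f (x,y) = -∫_y^1 f(x,z) dz`. -/
def iy (f : SF) : SF := fun x y => -∫ z in y..1, f x z

/-- "Sufficiently smooth" function on `Ω`: smooth and `1`-periodic in `x`. -/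
def SmoothF (f : SF) : Prop :=
  (∀ n : ℕ, ContDiff ℝ n (fun q : ℝ × ℝ => f q.1 q.2)) ∧
    ∀ y : ℝ, Function.Periodic (fun x => f x y) 1

/-- Smooth `1`-periodic function on `𝔾 = 𝕋`. -/
def SmoothP (g : ℝ → ℝ) : Prop :=
  (∀ n : ℕ, ContDiff ℝ n g) ∧ Function.Periodic g 1

/-- `n`-th Fourier coefficient of a `1`-periodic function. -/
def fc (g : ℝ → ℝ) (n : ℤ) : ℂ :=
  ∫ x in (0:ℝ)..1, Complex.exp (-(2 * π * (n : ℝ) * x : ℝ) * Complex.I) * (g x : ℂ)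

/-- Squared norm `| |D_x|^{1/2} g |₀²`, where `|D_x|` is the Fourier multiplier in `x`
with symbol `2π|n|`; computed via Plancherel. -/
def halfSq (g : ℝ → ℝ) : ℝ := ∑' n : ℤ, (2 * π * |(n : ℝ)|) * ‖fc g n‖ ^ 2

/-! ### Log-convex sequences -/

lemma le_endpoints_of_sq_le_mul {n : ℕ} {Q : ℕ → ℝ} (hQ : ∀ i, 0 ≤ Q i)
    (h : ∀ i, i + 2 ≤ n → Q (i + 1) ^ 2 ≤ Q i * Q (i + 2)) {i : ℕ} (hi : i ≤ n) :
    Q i ≤ Q 0 + Q n := by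
  classical
  have hex : ∃ m, m ≤ n ∧ ∀ j ≤ n, Q j ≤ Q m := by
    obtain ⟨m, hm, hmax⟩ := Finset.exists_max_image (Finset.range (n + 1)) Q ⟨0, by simp⟩
    exact ⟨m, by simpa [Nat.lt_succ_iff] using hm,
      fun j hj => hmax j (by simpa [Nat.lt_succ_iff] using hj)⟩
  obtain ⟨hm, hmax⟩ := Nat.find_spec hex
  have hmin : ∀ j < Nat.find hex, ¬ (j ≤ n ∧ ∀ l ≤ n, Q l ≤ Q j) :=
    fun j hj => Nat.find_min hex hj
  generalize Nat.find hex = m at hm hmax hmin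
  refine (hmax i hi).trans ?_
  rcases m with _ | j
  · linarith [hQ n]
  rcases hm.eq_or_lt with rfl | hlt
  · linarith [hQ 0]
  exfalso
  have hj : Q j < Q (j + 1) := by
    by_contra! hle
    exact hmin j (by omega) ⟨by omega, fun l hl => (hmax l hl).trans hle⟩
  have h1 := h j (by omega)
  have h2 := hmax (j + 2) (by omega)
  nlinarith [mul_le_mul_of_nonneg_left h2 (hQ j), hQ j]

lemma le_endpoints_of_sq_le_const_mul {n : ℕ} {P : ℕ → ℝ} {c : ℝ} (hc : 1 ≤ c)
    (hP : ∀ i, 0 ≤ P i)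
    (h : ∀ i, i + 2 ≤ n → P (i + 1) ^ 2 ≤ c ^ 2 * (P i * P (i + 2))) {i : ℕ} (hi : i ≤ n) :
    P i ≤ c ^ (n ^ 2) * (P 0 + P n) := by
  have hc0 : 0 ≤ c := zero_le_one.trans hc
  have key := le_endpoints_of_sq_le_mul (n := n) (Q := fun i => c ^ (i ^ 2) * P i)
    (fun i => mul_nonneg (pow_nonneg hc0 _) (hP i)) (fun i hi => by
      calc (c ^ ((i + 1) ^ 2) * P (i + 1)) ^ 2
          = (c ^ ((i + 1) ^ 2)) ^ 2 * P (i + 1) ^ 2 := by ring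
        _ ≤ (c ^ ((i + 1) ^ 2)) ^ 2 * (c ^ 2 * (P i * P (i + 2))) := by
            gcongr; exact h i hi
        _ = c ^ (i ^ 2) * P i * (c ^ ((i + 2) ^ 2) * P (i + 2)) := by ring) hi
  have h1 : P i ≤ c ^ (i ^ 2) * P i := le_mul_of_one_le_left (hP i) (one_le_pow₀ hc)
  have h2 : P 0 ≤ c ^ (n ^ 2) * P 0 := le_mul_of_one_le_left (hP 0) (one_le_pow₀ hc)
  simp only [ne_eq, OfNat.ofNat_ne_zero, not_false_eq_true, zero_pow, pow_zero, one_mul] at key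
  linarith

/-! ### One-variable inequalities -/

lemma abs_sub_le_integral_abs_deriv {u u' : ℝ → ℝ} (hu : ∀ x, HasDerivAt u (u' x) x)
    (hu' : Continuous u') {s x : ℝ} (hs : s ∈ Set.Icc (0 : ℝ) 1) (hx : x ∈ Set.Icc (0 : ℝ) 1) :
    |u x - u s| ≤ ∫ t in (0:ℝ)..1, |u' t| := by
  rw [← intervalIntegral.integral_eq_sub_of_hasDerivAt (fun t _ => hu t)
    (hu'.intervalIntegrable s x)]
  refine (intervalIntegral.norm_integral_le_integral_norm_uIoc (f := u')).trans ?_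
  rw [intervalIntegral.integral_of_le zero_le_one]
  refine setIntegral_mono_set ((hu'.abs.intervalIntegrable 0 1).1) (by
    filter_upwards with t using abs_nonneg _) (Set.Ioc_subset_Ioc ?_ ?_).eventuallyLE
  · exact le_min hs.1 hx.1
  · exact max_le hs.2 hx.2

lemma sq_le_integral_sq_add_sq_deriv {u u' : ℝ → ℝ} (hu : ∀ x, HasDerivAt u (u' x) x)
    (hu' : Continuous u') {x : ℝ} (hx : x ∈ Set.Icc (0 : ℝ) 1) :
    u x ^ 2 ≤ ∫ t in (0:ℝ)..1, (2 * u t ^ 2 + u' t ^ 2) := by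
  have huc : Continuous u := continuous_iff_continuousAt.2 fun x => (hu x).continuousAt
  have hd : ∀ t, HasDerivAt (fun t => u t ^ 2) (2 * u t * u' t) t := fun t => by
    simpa using (hu t).fun_pow 2
  have h1 : ∀ s ∈ Set.Icc (0 : ℝ) 1,
      u x ^ 2 ≤ u s ^ 2 + ∫ t in (0:ℝ)..1, (u t ^ 2 + u' t ^ 2) := fun s hs => by
    have h2 := abs_sub_le_integral_abs_deriv hd (by fun_prop) hs hx
    have h3 : ∫ t in (0:ℝ)..1, |2 * u t * u' t| ≤ ∫ t in (0:ℝ)..1, (u t ^ 2 + u' t ^ 2) :=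
      intervalIntegral.integral_mono_on zero_le_one
        (Continuous.intervalIntegrable (by fun_prop) _ _)
        (Continuous.intervalIntegrable (by fun_prop) _ _) fun t _ => by
          rw [abs_le]; constructor <;> nlinarith [sq_nonneg (u t - u' t), sq_nonneg (u t + u' t)]
    linarith [le_abs_self (u x ^ 2 - u s ^ 2)]
  have h4 := intervalIntegral.integral_mono_on (μ := volume) zero_le_one
    (intervalIntegrable_const) (Continuous.intervalIntegrable (by fun_prop) _ _) h1
  rw [intervalIntegral.integral_add (Continuous.intervalIntegrable (by fun_prop) _ _)
    intervalIntegrable_const] at h4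
  simp only [intervalIntegral.integral_const, sub_zero, one_smul] at h4
  rw [← intervalIntegral.integral_add (Continuous.intervalIntegrable (by fun_prop) _ _)
    (Continuous.intervalIntegrable (by fun_prop) _ _)] at h4
  refine h4.trans (le_of_eq ?_)
  congr 1; ext t; ring

lemma sq_integral_abs_le_integral_sq {u : ℝ → ℝ} (hu : Continuous u) :
    (∫ t in (0:ℝ)..1, |u t|) ^ 2 ≤ ∫ t in (0:ℝ)..1, u t ^ 2 := by
  set c := ∫ t in (0:ℝ)..1, |u t|
  have h1 : ∫ t in (0:ℝ)..1, (2 * c * |u t| - c ^ 2) ≤ ∫ t in (0:ℝ)..1, u t ^ 2 :=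
    intervalIntegral.integral_mono_on zero_le_one
      (Continuous.intervalIntegrable (by fun_prop) _ _)
      (Continuous.intervalIntegrable (by fun_prop) _ _) fun t _ => by
        nlinarith [sq_nonneg (|u t| - c), sq_abs (u t)]
  rw [intervalIntegral.integral_sub (Continuous.intervalIntegrable (by fun_prop) _ _)
    intervalIntegrable_const, intervalIntegral.integral_const_mul] at h1
  simp only [intervalIntegral.integral_const, sub_zero, one_smul] at h1
  change 2 * c * c - c ^ 2 ≤ _ at h1
  linarith

/-- Landau's inequality on the line, with a non-optimal constant. -/
lemma sq_deriv_le_of_abs_le {g g' g'' : ℝ → ℝ} (hg : ∀ x, HasDerivAt g (g' x) x)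
    (hg' : ∀ x, HasDerivAt g' (g'' x) x) {A B : ℝ} (hA : ∀ x, |g x| ≤ A)
    (hB : ∀ x, |g'' x| ≤ B) (x : ℝ) : g' x ^ 2 ≤ 8 * (A * B) := by
  have hB0 : 0 ≤ B := (abs_nonneg _).trans (hB 0)
  have h1 : ∀ t, |g' t - g' x| ≤ B * |t - x| := fun t =>
    convex_univ.norm_image_sub_le_of_norm_hasDerivWithin_le
      (fun s _ => (hg' s).hasDerivWithinAt) (fun s _ => hB s) (Set.mem_univ x) (Set.mem_univ t)
  have h2 : ∀ h : ℝ, 0 ≤ B * (h * h) + (-g' x) * h + 2 * A := fun h => by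
    have h3 := (convex_uIcc x (x + h)).norm_image_sub_le_of_norm_hasDerivWithin_le
      (f := fun t => g t - t * g' x) (f' := fun t => g' t - g' x) (C := B * |h|)
      (fun s _ => by
        simpa using ((hg s).fun_sub ((hasDerivAt_id s).mul_const (g' x))).hasDerivWithinAt)
      (fun s hs => (h1 s).trans (mul_le_mul_of_nonneg_left
        (by simpa using Set.abs_sub_left_of_mem_uIcc hs) hB0))
      Set.left_mem_uIcc Set.right_mem_uIcc
    simp only [Real.norm_eq_abs, add_sub_cancel_left] at h3
    rw [mul_assoc, abs_mul_abs_self] at h3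
    have h4 := (abs_le.1 h3).1
    have h5 := abs_le.1 (hA x)
    have h6 := abs_le.1 (hA (x + h))
    nlinarith
  have h7 := discrim_le_zero h2
  rw [discrim] at h7
  nlinarith

/-! ### Smooth functions on the strip -/

namespace SmoothF

variable {f g : SF}

lemma continuous (hf : SmoothF f) : Continuous fun q : ℝ × ℝ => f q.1 q.2 :=
  (hf.1 0).continuous

lemma differentiable (hf : SmoothF f) : Differentiable ℝ fun q : ℝ × ℝ => f q.1 q.2 :=
  (hf.1 1).differentiable (by simp)

lemma hasDerivAt_fst (hf : SmoothF f) (x y : ℝ) :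
    HasDerivAt (fun s => f s y) (fderiv ℝ (fun q : ℝ × ℝ => f q.1 q.2) (x, y) (1, 0)) x :=
  (hf.differentiable (x, y)).hasFDerivAt.comp_hasDerivAt (f := fun s => (s, y)) x
    ((hasDerivAt_id x).prodMk (hasDerivAt_const x y))

lemma hasDerivAt_snd (hf : SmoothF f) (x y : ℝ) :
    HasDerivAt (fun s => f x s) (fderiv ℝ (fun q : ℝ × ℝ => f q.1 q.2) (x, y) (0, 1)) y :=
  (hf.differentiable (x, y)).hasFDerivAt.comp_hasDerivAt (f := fun s => (x, s)) y
    ((hasDerivAt_const y x).prodMk (hasDerivAt_id y))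

lemma pdx_eq (hf : SmoothF f) (x y : ℝ) :
    pdx f x y = fderiv ℝ (fun q : ℝ × ℝ => f q.1 q.2) (x, y) (1, 0) :=
  (hf.hasDerivAt_fst x y).deriv

lemma pdy_eq (hf : SmoothF f) (x y : ℝ) :
    pdy f x y = fderiv ℝ (fun q : ℝ × ℝ => f q.1 q.2) (x, y) (0, 1) :=
  (hf.hasDerivAt_snd x y).deriv

lemma hasDerivAt_pdx (hf : SmoothF f) (x y : ℝ) :
    HasDerivAt (fun s => f s y) (_root_.pdx f x y) x :=
  (hf.hasDerivAt_fst x y).differentiableAt.hasDerivAt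

lemma hasDerivAt_pdy (hf : SmoothF f) (x y : ℝ) :
    HasDerivAt (fun s => f x s) (_root_.pdy f x y) y :=
  (hf.hasDerivAt_snd x y).differentiableAt.hasDerivAt

lemma contDiff_fderiv_apply (hf : SmoothF f) (v : ℝ × ℝ) (n : ℕ) :
    ContDiff ℝ n fun q => fderiv ℝ (fun q : ℝ × ℝ => f q.1 q.2) q v :=
  ((hf.1 (n + 1)).fderiv_right (m := n) (by norm_cast)).clm_apply contDiff_const

lemma pdx (hf : SmoothF f) : SmoothF (pdx f) := by
  refine ⟨fun n => ?_, fun y x => ?_⟩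
  · simp only [hf.pdx_eq]
    exact hf.contDiff_fderiv_apply (1, 0) n
  · have h : (fun s => f (s + 1) y) = fun s => f s y := funext (hf.2 y)
    simp only [_root_.pdx]
    rw [← deriv_comp_add_const (f := fun s => f s y), h]

lemma pdy (hf : SmoothF f) : SmoothF (pdy f) := by
  refine ⟨fun n => ?_, fun y x => ?_⟩
  · simp only [hf.pdy_eq]
    exact hf.contDiff_fderiv_apply (0, 1) n
  · simp only [_root_.pdy]
    congr 1
    exact funext fun s => hf.2 s x

lemma pdxn (hf : SmoothF f) (n : ℕ) : SmoothF (pdxn n f) := by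
  induction n with
  | zero => exact hf
  | succ n ih =>
    rw [_root_.pdxn, Function.iterate_succ_apply']
    exact ih.pdx

lemma pdy_pdx (hf : SmoothF f) : _root_.pdy (_root_.pdx f) = _root_.pdx (_root_.pdy f) := by
  have hd : Differentiable ℝ (fderiv ℝ fun q : ℝ × ℝ => f q.1 q.2) :=
    ((hf.1 2).fderiv_right (m := 1) (by norm_num)).differentiable (by simp)
  have happ (v w q : ℝ × ℝ) :
      fderiv ℝ (fun q => fderiv ℝ (fun q : ℝ × ℝ => f q.1 q.2) q v) q w =
        fderiv ℝ (fderiv ℝ fun q : ℝ × ℝ => f q.1 q.2) q w v := by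
    rw [fderiv_clm_apply (hd q) (differentiableAt_const v)]
    simp
  have hsymm (q : ℝ × ℝ) : IsSymmSndFDerivAt ℝ (fun q : ℝ × ℝ => f q.1 q.2) q :=
    (hf.1 2).contDiffAt.isSymmSndFDerivAt (by simp)
  ext x y
  rw [hf.pdx.pdy_eq, hf.pdy.pdx_eq]
  simp only [hf.pdx_eq, hf.pdy_eq]
  exact (happ _ _ _).trans ((hsymm _ _ _).trans (happ _ _ _).symm)

lemma pdy_pdxn (hf : SmoothF f) (n : ℕ) :
    _root_.pdy (_root_.pdxn n f) = _root_.pdxn n (_root_.pdy f) := by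
  induction n with
  | zero => rfl
  | succ n ih =>
    simp only [_root_.pdxn, Function.iterate_succ_apply'] at ih ⊢
    rw [← ih]
    exact (hf.pdxn n).pdy_pdx

end SmoothF

lemma pdxn_succ (n : ℕ) (f : SF) : pdxn (n + 1) f = pdx (pdxn n f) :=
  Function.iterate_succ_apply' _ _ _

lemma pdxn_eq_iteratedDeriv (n : ℕ) (f : SF) (x y : ℝ) :
    pdxn n f x y = iteratedDeriv n (fun s => f s y) x := by
  induction n generalizing x with
  | zero => simp [pdxn]
  | succ n ih =>
    rw [pdxn_succ, iteratedDeriv_succ, ← funext ih]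
    rfl

/-- Leibniz formula for the commutator of `∂_x^k` with multiplication by `a`. -/
lemma commutator_eq_sum {a f : SF} (ha : SmoothF a) (hf : SmoothF f) (k : ℕ) (x y : ℝ) :
    pdxn k (fun x' y' => a x' y' * f x' y') x y - a x y * pdxn k f x y =
      ∑ i ∈ Finset.range k,
        (k.choose (i + 1) : ℝ) * (pdxn (i + 1) a x y * pdxn (k - (i + 1)) f x y) := by
  have hsec {g : SF} (hg : SmoothF g) : ContDiffAt ℝ k (fun s => g s y) x :=
    ((hg.1 k).comp (contDiff_id.prodMk contDiff_const)).contDiffAt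
  simp only [pdxn_eq_iteratedDeriv]
  rw [iteratedDeriv_fun_mul (hsec ha) (hsec hf), Finset.sum_range_succ']
  simp [mul_assoc]

/-! ### The supremum norm -/

lemma linf_nonneg (f : SF) : 0 ≤ linf f := Real.iSup_nonneg fun _ => abs_nonneg _

lemma linf_le {f : SF} {M : ℝ}
    (h : ∀ x ∈ Set.Icc (0:ℝ) 1, ∀ y ∈ Set.Icc (0:ℝ) 1, |f x y| ≤ M) : linf f ≤ M :=
  ciSup_le fun q => h _ q.1.2 _ q.2.2

lemma SmoothF.abs_le_linf {f : SF} (hf : SmoothF f) (x : ℝ) {y : ℝ}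
    (hy : y ∈ Set.Icc (0:ℝ) 1) : |f x y| ≤ linf f := by
  obtain ⟨x', hx', h⟩ := (hf.2 y).exists_mem_Ico₀ one_pos x
  have hc : Continuous fun q : Set.Icc (0:ℝ) 1 × Set.Icc (0:ℝ) 1 => |f q.1.1 q.2.1| :=
    (hf.continuous.comp (by fun_prop : Continuous
      fun q : Set.Icc (0:ℝ) 1 × Set.Icc (0:ℝ) 1 => ((q.1.1, q.2.1) : ℝ × ℝ))).abs
  have h' : f x y = f x' y := h
  rw [h']
  exact le_ciSup (isCompact_range hc).bddAbove (⟨⟨x', hx'.1, hx'.2.le⟩, ⟨y, hy⟩⟩ :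
    Set.Icc (0:ℝ) 1 × Set.Icc (0:ℝ) 1)

lemma SmoothF.linf_pdx_sq_le {f : SF} (hf : SmoothF f) :
    linf (_root_.pdx f) ^ 2 ≤ 8 * (linf f * linf (_root_.pdx (_root_.pdx f))) := by
  have h0 : 0 ≤ 8 * (linf f * linf (_root_.pdx (_root_.pdx f))) :=
    mul_nonneg (by norm_num) (mul_nonneg (linf_nonneg _) (linf_nonneg _))
  rw [← Real.le_sqrt (linf_nonneg _) h0]
  refine linf_le fun x _ y hy => Real.abs_le_sqrt ?_
  exact sq_deriv_le_of_abs_le (fun x => hf.hasDerivAt_pdx x y) (fun x => hf.pdx.hasDerivAt_pdx x y)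
    (fun x => hf.abs_le_linf x hy) (fun x => hf.pdx.pdx.abs_le_linf x hy) x

/-! ### Integrals over the strip -/

/-- The integral `∫_Ω u` over one period of the strip. -/
def stripIntegral (u : SF) : ℝ := ∫ x in (0:ℝ)..1, ∫ y in (0:ℝ)..1, u x y

section StripIntegral

variable {u v : SF}

lemma continuous_inner_integral (hu : Continuous fun q : ℝ × ℝ => u q.1 q.2) :
    Continuous fun x => ∫ y in (0:ℝ)..1, u x y :=
  intervalIntegral.continuous_parametric_intervalIntegral_of_continuous' hu 0 1

lemma intervalIntegrable_snd (hu : Continuous fun q : ℝ × ℝ => u q.1 q.2) (x : ℝ) :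
    IntervalIntegrable (fun y => u x y) volume 0 1 :=
  (hu.comp (Continuous.prodMk_right x)).intervalIntegrable 0 1

lemma intervalIntegrable_inner_integral (hu : Continuous fun q : ℝ × ℝ => u q.1 q.2) :
    IntervalIntegrable (fun x => ∫ y in (0:ℝ)..1, u x y) volume 0 1 :=
  (continuous_inner_integral hu).intervalIntegrable 0 1

lemma stripIntegral_mono (hu : Continuous fun q : ℝ × ℝ => u q.1 q.2)
    (hv : Continuous fun q : ℝ × ℝ => v q.1 q.2)
    (h : ∀ x ∈ Set.Icc (0:ℝ) 1, ∀ y ∈ Set.Icc (0:ℝ) 1, u x y ≤ v x y) :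
    stripIntegral u ≤ stripIntegral v :=
  intervalIntegral.integral_mono_on zero_le_one (intervalIntegrable_inner_integral hu)
    (intervalIntegrable_inner_integral hv) fun x hx =>
      intervalIntegral.integral_mono_on zero_le_one (intervalIntegrable_snd hu x)
        (intervalIntegrable_snd hv x) (h x hx)

lemma stripIntegral_add (hu : Continuous fun q : ℝ × ℝ => u q.1 q.2)
    (hv : Continuous fun q : ℝ × ℝ => v q.1 q.2) :
    stripIntegral (fun x y => u x y + v x y) = stripIntegral u + stripIntegral v := by
  simp only [stripIntegral]
  rw [← intervalIntegral.integral_add (intervalIntegrable_inner_integral hu)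
    (intervalIntegrable_inner_integral hv)]
  congr 1; ext x
  exact intervalIntegral.integral_add (intervalIntegrable_snd hu x) (intervalIntegrable_snd hv x)

lemma stripIntegral_const_mul (c : ℝ) (u : SF) :
    stripIntegral (fun x y => c * u x y) = c * stripIntegral u := by
  simp [stripIntegral]

lemma stripIntegral_finsetSum {ι : Type*} (s : Finset ι) {w : ι → SF}
    (hw : ∀ i ∈ s, Continuous fun q : ℝ × ℝ => w i q.1 q.2) :
    stripIntegral (fun x y => ∑ i ∈ s, w i x y) = ∑ i ∈ s, stripIntegral (w i) := by
  simp only [stripIntegral]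
  rw [← intervalIntegral.integral_finsetSum
    fun i hi => intervalIntegrable_inner_integral (hw i hi)]
  congr 1; ext x
  exact intervalIntegral.integral_finsetSum fun i hi => intervalIntegrable_snd (hw i hi) x

lemma stripIntegral_eq_swap (hu : Continuous fun q : ℝ × ℝ => u q.1 q.2) :
    stripIntegral u = ∫ y in (0:ℝ)..1, ∫ x in (0:ℝ)..1, u x y := by
  refine intervalIntegral_intervalIntegral_swap ?_
  have hc : IsCompact (Set.uIcc (0:ℝ) 1 ×ˢ Set.uIcc (0:ℝ) 1) := isCompact_uIcc.prod isCompact_uIcc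
  exact (ContinuousOn.integrableOn_compact hc (Continuous.continuousOn hu)).mono_set
    (Set.prod_mono Set.uIoc_subset_uIcc Set.uIoc_subset_uIcc)

lemma nSq_eq_stripIntegral (u : SF) : nSq u = stripIntegral fun x y => u x y ^ 2 := rfl

lemma nSq_nonneg (u : SF) : 0 ≤ nSq u :=
  intervalIntegral.integral_nonneg zero_le_one fun _ _ =>
    intervalIntegral.integral_nonneg zero_le_one fun _ _ => sq_nonneg _

lemma nSq_const_mul (c : ℝ) (u : SF) : nSq (fun x y => c * u x y) = c ^ 2 * nSq u := by
  simp only [nSq_eq_stripIntegral, mul_pow, stripIntegral_const_mul]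

lemma nSq_finsetSum_le {ι : Type*} (s : Finset ι) {w : ι → SF}
    (hw : ∀ i ∈ s, Continuous fun q : ℝ × ℝ => w i q.1 q.2) :
    nSq (fun x y => ∑ i ∈ s, w i x y) ≤ s.card * ∑ i ∈ s, nSq (w i) := by
  have hw2 : ∀ i ∈ s, Continuous fun q : ℝ × ℝ => w i q.1 q.2 ^ 2 := fun i hi => (hw i hi).pow 2
  simp only [nSq_eq_stripIntegral]
  rw [← stripIntegral_finsetSum (w := fun i x y => w i x y ^ 2) s hw2, ← stripIntegral_const_mul]
  exact stripIntegral_mono ((continuous_finsetSum s hw).pow 2)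
    (continuous_const.mul (continuous_finsetSum s hw2)) fun x _ y _ => sq_sum_le_card_mul_sum_sq

end StripIntegral

namespace SmoothF

variable {a b f : SF}

lemma stripIntegral_mul_pdx_pdx (hf : SmoothF f) :
    stripIntegral (fun x y => f x y * _root_.pdx (_root_.pdx f) x y) = -nSq (_root_.pdx f) := by
  rw [nSq_eq_stripIntegral,
    stripIntegral_eq_swap (u := fun x y => f x y * _root_.pdx (_root_.pdx f) x y)
      (hf.continuous.mul hf.pdx.pdx.continuous),
    stripIntegral_eq_swap (u := fun x y => _root_.pdx f x y ^ 2) (hf.pdx.continuous.pow 2),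
    ← intervalIntegral.integral_neg]
  congr 1; ext y
  have hcont {g : SF} (hg : SmoothF g) : Continuous fun x => g x y :=
    hg.continuous.comp (Continuous.prodMk_left y)
  have hper {g : SF} (hg : SmoothF g) : g 1 y = g 0 y := by simpa using hg.2 y 0
  rw [intervalIntegral.integral_mul_deriv_eq_deriv_mul (fun x _ => hf.hasDerivAt_pdx x y)
    (fun x _ => hf.pdx.hasDerivAt_pdx x y) ((hcont hf.pdx).intervalIntegrable 0 1)
    ((hcont hf.pdx.pdx).intervalIntegrable 0 1), hper hf, hper hf.pdx, sub_self, zero_sub]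
  simp only [sq]

lemma nSq_pdx_sq_le (hf : SmoothF f) :
    nSq (_root_.pdx f) ^ 2 ≤ nSq f * nSq (_root_.pdx (_root_.pdx f)) := by
  have hc0 := hf.continuous
  have hc2 := hf.pdx.pdx.continuous
  have key : ∀ t : ℝ, 0 ≤ nSq (_root_.pdx (_root_.pdx f)) * (t * t) +
      (-2 * nSq (_root_.pdx f)) * t + nSq f := fun t => by
    have h : nSq (fun x y => f x y + t * _root_.pdx (_root_.pdx f) x y) =
        nSq f + (2 * t * -nSq (_root_.pdx f) + t ^ 2 * nSq (_root_.pdx (_root_.pdx f))) := by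
      rw [← hf.stripIntegral_mul_pdx_pdx]
      simp only [nSq_eq_stripIntegral, ← stripIntegral_const_mul]
      rw [← stripIntegral_add (by fun_prop) (by fun_prop),
        ← stripIntegral_add (by fun_prop) (by fun_prop)]
      congr 1; ext x y; ring
    have h0 := nSq_nonneg fun x y => f x y + t * _root_.pdx (_root_.pdx f) x y
    rw [h] at h0
    linarith
  have h := discrim_le_zero key
  rw [discrim] at h
  linarith

lemma sqrt_nSq_pdx_sq_le (hf : SmoothF f) :
    √(nSq (_root_.pdx f)) ^ 2 ≤ √(nSq f) * √(nSq (_root_.pdx (_root_.pdx f))) := by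
  rw [Real.sq_sqrt (nSq_nonneg _), ← Real.sqrt_mul (nSq_nonneg _)]
  exact Real.le_sqrt_of_sq_le hf.nSq_pdx_sq_le

lemma nSq_mul_le (ha : SmoothF a) (hf : SmoothF f) :
    nSq (fun x y => a x y * f x y) ≤ linf a ^ 2 * nSq f := by
  have hac := ha.continuous
  have hfc := hf.continuous
  simp only [nSq_eq_stripIntegral, ← stripIntegral_const_mul]
  refine stripIntegral_mono (by fun_prop) (by fun_prop) fun x _ y hy => ?_
  rw [mul_pow, ← sq_abs (a x y)]
  gcongr
  exact ha.abs_le_linf x hy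

lemma integral_sq_add_sq_eq (hb : SmoothF b) {c : SF} (hc : SmoothF c) :
    ∫ x in (0:ℝ)..1, ∫ y in (0:ℝ)..1, (2 * b x y ^ 2 + c x y ^ 2) = 2 * nSq b + nSq c := by
  have hbc := hb.continuous
  have hcc := hc.continuous
  simp only [nSq_eq_stripIntegral, ← stripIntegral_const_mul]
  rw [← stripIntegral_add (by fun_prop) (by fun_prop)]
  rfl

lemma integral_sq_add_sq_eq' (hb : SmoothF b) {c : SF} (hc : SmoothF c) :
    ∫ y in (0:ℝ)..1, ∫ x in (0:ℝ)..1, (2 * b x y ^ 2 + c x y ^ 2) = 2 * nSq b + nSq c := by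
  have hbc := hb.continuous
  have hcc := hc.continuous
  rw [← hb.integral_sq_add_sq_eq hc]
  exact (stripIntegral_eq_swap (u := fun x y => 2 * b x y ^ 2 + c x y ^ 2) (by fun_prop)).symm

lemma sq_le_integral_snd (hb : SmoothF b) (x : ℝ) {y : ℝ} (hy : y ∈ Set.Icc (0:ℝ) 1) :
    b x y ^ 2 ≤ ∫ y in (0:ℝ)..1, (2 * b x y ^ 2 + _root_.pdy b x y ^ 2) :=
  sq_le_integral_sq_add_sq_deriv (fun y => hb.hasDerivAt_pdy x y)
    (hb.pdy.continuous.comp (Continuous.prodMk_right x)) hy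

lemma sq_le_integral_fst (hb : SmoothF b) {x : ℝ} (hx : x ∈ Set.Icc (0:ℝ) 1) (y : ℝ) :
    b x y ^ 2 ≤ ∫ x in (0:ℝ)..1, (2 * b x y ^ 2 + _root_.pdx b x y ^ 2) :=
  sq_le_integral_sq_add_sq_deriv (fun x => hb.hasDerivAt_pdx x y)
    (hb.pdx.continuous.comp (Continuous.prodMk_left y)) hx

/-- Anisotropic product estimate, `L²_x L^∞_y` against `L^∞_x L²_y`. -/
lemma nSq_mul_le_anisotropic (hb : SmoothF b) (hf : SmoothF f) :
    nSq (fun x y => b x y * f x y) ≤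
      (2 * nSq b + nSq (_root_.pdy b)) * (2 * nSq f + nSq (_root_.pdx f)) := by
  have hbc := hb.continuous
  have hbc' := hb.pdy.continuous
  have hfc := hf.continuous
  have hfc' := hf.pdx.continuous
  set ψ : ℝ → ℝ := fun x => ∫ y in (0:ℝ)..1, (2 * b x y ^ 2 + _root_.pdy b x y ^ 2) with hψ
  set φ : ℝ → ℝ := fun y => ∫ x in (0:ℝ)..1, (2 * f x y ^ 2 + _root_.pdx f x y ^ 2) with hφ
  have hψc : Continuous ψ := continuous_inner_integral
    (u := fun x y => 2 * b x y ^ 2 + _root_.pdy b x y ^ 2) (by fun_prop)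
  have hφc : Continuous φ := continuous_inner_integral
    (u := fun y x => 2 * f x y ^ 2 + _root_.pdx f x y ^ 2)
    (Continuous.comp (g := fun q : ℝ × ℝ => 2 * f q.1 q.2 ^ 2 + _root_.pdx f q.1 q.2 ^ 2)
      (by fun_prop) continuous_swap)
  calc nSq (fun x y => b x y * f x y)
      ≤ stripIntegral fun x y => ψ x * φ y := by
        refine stripIntegral_mono (by fun_prop) (by fun_prop) fun x hx y hy => ?_
        rw [mul_pow]
        exact mul_le_mul (hb.sq_le_integral_snd x hy) (hf.sq_le_integral_fst hx y) (sq_nonneg _)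
          ((sq_nonneg _).trans (hb.sq_le_integral_snd x hy))
    _ = (∫ x in (0:ℝ)..1, ψ x) * ∫ y in (0:ℝ)..1, φ y := by
        simp only [stripIntegral, intervalIntegral.integral_const_mul,
          intervalIntegral.integral_mul_const]
    _ = _ := by
        rw [hψ, hφ, hb.integral_sq_add_sq_eq hb.pdy, hf.integral_sq_add_sq_eq' hf.pdx]

lemma linf_pdx_sq_le_nSq (hf : SmoothF f) :
    linf (_root_.pdx f) ^ 2 ≤ 2 * nSq (_root_.pdx (_root_.pdx f)) +
      nSq (_root_.pdy (_root_.pdx (_root_.pdx f))) := by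
  set w := _root_.pdx (_root_.pdx f)
  have hw : SmoothF w := hf.pdx.pdx
  have hwc := hw.continuous
  have hwc' := hw.pdy.continuous
  have h0 : 0 ≤ 2 * nSq w + nSq (_root_.pdy w) :=
    add_nonneg (mul_nonneg zero_le_two (nSq_nonneg _)) (nSq_nonneg _)
  rw [← Real.le_sqrt (linf_nonneg _) h0]
  refine linf_le fun x hx y hy => Real.abs_le_sqrt ?_
  have hcy {g : SF} (hg : SmoothF g) : Continuous fun x => g x y :=
    hg.continuous.comp (Continuous.prodMk_left y)
  obtain ⟨s, hs, hs0⟩ := exists_deriv_eq_zero (f := fun s => f s y) one_pos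
    (hcy hf).continuousOn (by simpa using (hf.2 y 0).symm)
  have h1 := abs_sub_le_integral_abs_deriv (fun x => hf.pdx.hasDerivAt_pdx x y) (hcy hw)
    (Set.Ioo_subset_Icc_self hs) hx
  rw [show _root_.pdx f s y = 0 from hs0, sub_zero] at h1
  calc _root_.pdx f x y ^ 2 = |_root_.pdx f x y| ^ 2 := (sq_abs _).symm
    _ ≤ (∫ t in (0:ℝ)..1, |w t y|) ^ 2 := by gcongr
    _ ≤ ∫ t in (0:ℝ)..1, w t y ^ 2 := sq_integral_abs_le_integral_sq (hcy hw)
    _ ≤ ∫ t in (0:ℝ)..1, ∫ y in (0:ℝ)..1, (2 * w t y ^ 2 + _root_.pdy w t y ^ 2) :=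
        intervalIntegral.integral_mono_on zero_le_one
          (((hcy hw).pow 2).intervalIntegrable 0 1)
          (intervalIntegrable_inner_integral
            (u := fun x y => 2 * w x y ^ 2 + _root_.pdy w x y ^ 2) (by fun_prop))
          fun t _ => hw.sq_le_integral_snd t hy
    _ = _ := hw.integral_sq_add_sq_eq hw.pdy

lemma sqrt_nSq_pdxn_mul_pdxn_le (ha : SmoothF a) (hf : SmoothF f) {n i : ℕ} (hi : i ≤ n) :
    √(nSq fun x y => _root_.pdxn (i + 1) a x y * _root_.pdxn (n - i + 1) f x y) ≤
      3 ^ (n ^ 2) * (linf (_root_.pdx a) * √(nSq (_root_.pdxn (n + 1) f)) +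
        linf (_root_.pdxn (n + 1) a) * √(nSq (_root_.pdx f))) := by
  have key := le_endpoints_of_sq_le_const_mul (n := n) (c := 3)
    (P := fun i => linf (_root_.pdxn (i + 1) a) * √(nSq (_root_.pdxn (n - i + 1) f)))
    (by norm_num) (fun i => mul_nonneg (linf_nonneg _) (Real.sqrt_nonneg _)) (fun j hj => by
      obtain ⟨d, rfl⟩ := Nat.exists_eq_add_of_le hj
      have e1 : j + 2 + d - (j + 1) + 1 = d + 1 + 1 := by omega
      have e2 : j + 2 + d - j + 1 = d + 1 + 1 + 1 := by omega
      have e3 : j + 2 + d - (j + 2) + 1 = d + 1 := by omega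
      simp only [e1, e2, e3]
      have h1 := (ha.pdxn (j + 1)).linf_pdx_sq_le
      have h2 := (hf.pdxn (d + 1)).sqrt_nSq_pdx_sq_le
      simp only [← pdxn_succ] at h1 h2
      rw [mul_pow]
      refine (mul_le_mul h1 h2 (sq_nonneg _) ((sq_nonneg _).trans h1)).trans ?_
      have h3 := mul_nonneg
        (mul_nonneg (linf_nonneg (_root_.pdxn (j + 1) a)) (linf_nonneg (_root_.pdxn (j + 2 + 1) a)))
        (mul_nonneg (Real.sqrt_nonneg (nSq (_root_.pdxn (d + 1) f)))
          (Real.sqrt_nonneg (nSq (_root_.pdxn (d + 1 + 1 + 1) f))))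
      change 8 * (linf (_root_.pdxn (j + 1) a) * linf (_root_.pdxn (j + 2 + 1) a)) * _ ≤ _
      linarith) hi
  simp only [zero_add, Nat.sub_zero, Nat.sub_self] at key
  refine le_trans ?_ key
  rw [← Real.sqrt_sq (linf_nonneg (_root_.pdxn (i + 1) a)), ← Real.sqrt_mul (sq_nonneg _)]
  exact Real.sqrt_le_sqrt ((ha.pdxn _).nSq_mul_le (hf.pdxn _))

end SmoothF

lemma sqrt_two_mul_add_le {p q : ℝ} (hp : 0 ≤ p) (hq : 0 ≤ q) : √(2 * p + q) ≤ 2 * √p + √q := by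
  rw [Real.sqrt_le_left (by positivity)]
  nlinarith [Real.sq_sqrt hp, Real.sq_sqrt hq, mul_nonneg (Real.sqrt_nonneg p) (Real.sqrt_nonneg q)]

/-- Each term of the Leibniz expansion of the commutator obeys the commutator estimate. -/
lemma sqrt_nSq_leibniz_term_le {a f : SF} (ha : SmoothF a) (hf : SmoothF f) {k i : ℕ}
    (hi : i < k) :
    √(nSq fun x y => pdxn (i + 1) a x y * pdxn (k - (i + 1)) f x y) ≤
      4 * 3 ^ (k ^ 2) * (linf (pdx a) * √(nSq (pdxn (k - 1) f)) +
        (√(nSq (pdxn k a)) + √(nSq (pdxn k (pdy a)))) * (√(nSq f) + √(nSq (pdx f)))) := by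
  have hα := Real.sqrt_nonneg (nSq (pdxn k a))
  have hβ := Real.sqrt_nonneg (nSq (pdxn k (pdy a)))
  have hp := Real.sqrt_nonneg (nSq f)
  have hq := Real.sqrt_nonneg (nSq (pdx f))
  have hL := mul_nonneg (linf_nonneg (pdx a)) (Real.sqrt_nonneg (nSq (pdxn (k - 1) f)))
  have h3 : (1 : ℝ) ≤ 3 ^ (k ^ 2) := one_le_pow₀ (by norm_num)
  have hR : 0 ≤ linf (pdx a) * √(nSq (pdxn (k - 1) f)) +
      (√(nSq (pdxn k a)) + √(nSq (pdxn k (pdy a)))) * (√(nSq f) + √(nSq (pdx f))) := by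
    positivity
  have hM : √(2 * nSq (pdxn k a) + nSq (pdxn k (pdy a))) ≤
      2 * (√(nSq (pdxn k a)) + √(nSq (pdxn k (pdy a)))) :=
    (sqrt_two_mul_add_le (nSq_nonneg _) (nSq_nonneg _)).trans (by linarith)
  rcases Nat.lt_or_ge (i + 1) k with hlt | hge
  · obtain ⟨n, rfl⟩ : ∃ n, k = n + 2 := ⟨k - 2, by omega⟩
    have e : n + 2 - (i + 1) = n - i + 1 := by omega
    rw [e]
    refine (ha.sqrt_nSq_pdxn_mul_pdxn_le hf (by omega : i ≤ n)).trans ?_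
    have hA : linf (pdxn (n + 1) a) ≤
        2 * (√(nSq (pdxn (n + 2) a)) + √(nSq (pdxn (n + 2) (pdy a)))) := by
      have h := (ha.pdxn n).linf_pdx_sq_le_nSq
      simp only [← pdxn_succ, ha.pdy_pdxn] at h
      exact (Real.le_sqrt_of_sq_le h).trans hM
    have hpow : (3 : ℝ) ^ (n ^ 2) ≤ 3 ^ ((n + 2) ^ 2) :=
      pow_le_pow_right₀ (by norm_num) (Nat.pow_le_pow_left (by omega) 2)
    have h4 := mul_le_mul_of_nonneg_right hA hq
    have h5 := mul_nonneg (add_nonneg hα hβ) hp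
    have h6 := mul_nonneg (add_nonneg hα hβ) hq
    rw [mul_comm (4 : ℝ), mul_assoc]
    refine mul_le_mul hpow ?_ (add_nonneg hL (mul_nonneg (linf_nonneg _) hq)) (by positivity)
    change _ ≤ 4 * (linf (pdx a) * √(nSq (pdxn (n + 1) f)) + _)
    change 0 ≤ linf (pdx a) * √(nSq (pdxn (n + 1) f)) at hL
    linarith
  · obtain rfl : i + 1 = k := by omega
    rw [Nat.sub_self]
    have h := Real.sqrt_le_sqrt ((ha.pdxn (i + 1)).nSq_mul_le_anisotropic hf)
    rw [Real.sqrt_mul (add_nonneg (mul_nonneg zero_le_two (nSq_nonneg _)) (nSq_nonneg _)),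
      ha.pdy_pdxn] at h
    have hN : √(2 * nSq f + nSq (pdx f)) ≤ 2 * (√(nSq f) + √(nSq (pdx f))) :=
      (sqrt_two_mul_add_le (nSq_nonneg _) (nSq_nonneg _)).trans (by linarith)
    have h4 := h.trans (mul_le_mul hM hN (Real.sqrt_nonneg _) (by positivity))
    refine h4.trans ?_
    refine le_trans ?_ (mul_le_mul_of_nonneg_right
      (by linarith : (4 : ℝ) ≤ 4 * 3 ^ ((i + 1) ^ 2)) hR)
    linarith

/-- **Lemma 5.3 (anisotropic commutator estimate).** For any integer `k ≥ 1` and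
sufficiently smooth `a`, `f` on `Ω`, the commutator
`[∂_x^k, a]f = ∂_x^k(af) − a ∂_x^k f` satisfies
`‖[∂_x^k,a]f‖ ≲ ‖a_x‖_∞‖∂_x^{k−1}f‖ + (‖∂_x^k a‖+‖∂_x^k a_y‖)(‖f‖+‖f_x‖)`,
with implicit constant depending only on `k`. -/
theorem commutator_estimate (k : ℕ) (hk : 1 ≤ k) :
    ∃ C : ℝ, 0 < C ∧ ∀ a f : SF, SmoothF a → SmoothF f →
      Real.sqrt (nSq (fun x y =>
          pdxn k (fun x' y' => a x' y' * f x' y') x y - a x y * pdxn k f x y)) ≤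
        C * (linf (pdx a) * Real.sqrt (nSq (pdxn (k-1) f)) +
          (Real.sqrt (nSq (pdxn k a)) + Real.sqrt (nSq (pdxn k (pdy a)))) *
            (Real.sqrt (nSq f) + Real.sqrt (nSq (pdx f)))) := by
  set D : ℝ := k * ∑ i ∈ Finset.range k, (k.choose (i + 1) : ℝ) ^ 2
  refine ⟨√D * (4 * 3 ^ (k ^ 2)) + 1, by positivity, fun a f ha hf => ?_⟩
  simp only [commutator_eq_sum ha hf]
  set R := linf (pdx a) * √(nSq (pdxn (k - 1) f)) +
    (√(nSq (pdxn k a)) + √(nSq (pdxn k (pdy a)))) * (√(nSq f) + √(nSq (pdx f)))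
  have hR : 0 ≤ R := add_nonneg (mul_nonneg (linf_nonneg _) (Real.sqrt_nonneg _)) (by positivity)
  have hterm : ∀ i ∈ Finset.range k,
      nSq (fun x y => (k.choose (i + 1) : ℝ) *
        (pdxn (i + 1) a x y * pdxn (k - (i + 1)) f x y)) ≤
      (k.choose (i + 1) : ℝ) ^ 2 * (4 * 3 ^ (k ^ 2) * R) ^ 2 := fun i hi => by
    rw [nSq_const_mul]
    gcongr
    rw [← Real.sqrt_le_left (by positivity)]
    exact sqrt_nSq_leibniz_term_le ha hf (Finset.mem_range.1 hi)
  have hsum := nSq_finsetSum_le (Finset.range k)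
    (w := fun i x y => (k.choose (i + 1) : ℝ) *
      (pdxn (i + 1) a x y * pdxn (k - (i + 1)) f x y))
    fun i _ => continuous_const.mul ((ha.pdxn _).continuous.mul (hf.pdxn _).continuous)
  have hle := hsum.trans (mul_le_mul_of_nonneg_left (Finset.sum_le_sum hterm) (Nat.cast_nonneg _))
  rw [← Finset.sum_mul, ← mul_assoc, Finset.card_range] at hle
  refine (Real.sqrt_le_sqrt hle).trans ?_
  rw [Real.sqrt_mul (by positivity), Real.sqrt_sq (by positivity)]
  change √D * _ ≤ _
  linarith
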